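/- arXiv:math/9409218 — 14 statements merged into one kernel-verified Lean document; each statement's English description precedes it below -/
import Mathlib

section
/- Let P be a finite partial order and let {H_α} be a family of closure relations on P. Let S be the join, in the lattice of equivalence relations (setoids) on the underlying set of P, of the equivalence relations induced by the H_α (where x ~_{H_α} y iff H_α(x) = H_α(y)). Then every equivalence class of S has a greatest element with respect to the order on P. -/
/-- Points related by the join of the kernels of closure operators have the same upper bounds
among the common closed points. -/
theorem le_iff_le_of_iSup_ker {P : Type*} [PartialOrder P] {ι : Type*}
    (H : ι → ClosureOperator P) {m : P} (hm : ∀ i, (H i).IsClosed m) {x y : P}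
    (hxy : (⨆ i, Setoid.ker ⇑(H i)) x y) : x ≤ m ↔ y ≤ m := by
  have hle : (⨆ i, Setoid.ker ⇑(H i)) ≤ Setoid.ker (fun a : P => a ≤ m) := by
    refine iSup_le fun i => Setoid.le_def.2 fun {a b} hab => ?_
    rw [Setoid.ker_def] at hab ⊢
    rw [← (hm i).closure_le_iff, hab, (hm i).closure_le_iff]
  exact iff_of_eq (Setoid.ker_def.1 (Setoid.le_def.1 hle hxy))


/-- Let `{H_α}` be a family of closure relations on a finite poset `P`, and let
`S` be the join, in the lattice of equivalence relations on `P`, of the equivalence relations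
`x ~ y ↔ H_α x = H_α y` induced by the `H_α`.  Then every `S`-equivalence class has a greatest
element with respect to the order on `P`. -/
theorem join_setoid_classes_have_greatest {P : Type*} [PartialOrder P] [Finite P]
    {ι : Type*} (H : ι → ClosureOperator P) :
    ∀ x : P, ∃ g : P, (⨆ i, Setoid.ker ⇑(H i)) x g ∧
      ∀ y : P, (⨆ i, Setoid.ker ⇑(H i)) x y → y ≤ g := by
  intro x
  obtain ⟨g, hg⟩ := (Set.toFinite {y | (⨆ i, Setoid.ker ⇑(H i)) x y}).exists_maximal
    ⟨x, Setoid.refl' (⨆ i, Setoid.ker ⇑(H i)) x⟩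
  have hclosed : ∀ i, (H i).IsClosed g := fun i => by
    have hker : (⨆ i, Setoid.ker ⇑(H i)) g (H i g) :=
      Setoid.le_def.1 (le_iSup (fun i => Setoid.ker ⇑(H i)) i)
        (Setoid.ker_def.2 ((H i).idempotent g).symm)
    exact (H i).isClosed_iff_closure_le.2
      (hg.2 (Setoid.trans' _ hg.1 hker) ((H i).le_closure g))
  exact ⟨g, hg.1, fun y hy => (le_iff_le_of_iSup_ker H hclosed
    (Setoid.trans' _ (Setoid.symm' _ hg.1) hy)).1 le_rfl⟩
end

section
/- Let P be a finite partial order and let {H_α} be a family of closure relations on P. Let S be the join, in the lattice of equivalence relations on the underlying set of P, of the equivalence relations induced by the H_α, and define J : P → P by sending each x to the greatest element of its S-equivalence class. Then J is a closure relation on P, and J is the least upper bound of the family {H_α} in the pointwise order on closure relations. -/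
/-- Let `{H_α}` be a family of closure relations on a finite poset `P`, let `S` be
the join (in the lattice of equivalence relations on `P`) of the induced equivalence relations,
and let `J : P → P` send each element to the greatest element of its `S`-class.  Then `J` is a
closure relation on `P` and is the least upper bound of the family `{H_α}` in the pointwise
order on closure relations. -/
theorem join_closure_is_lub {P : Type*} [PartialOrder P] [Finite P]
    {ι : Type*} (H : ι → ClosureOperator P) (J : P → P)
    (hJ : ∀ x : P, (⨆ i, Setoid.ker ⇑(H i)) x (J x) ∧
      ∀ y : P, (⨆ i, Setoid.ker ⇑(H i)) x y → y ≤ J x) :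
    (∀ x : P, x ≤ J x) ∧ Monotone J ∧ (∀ x : P, J (J x) = J x) ∧
      (∀ i x, H i x ≤ J x) ∧
      (∀ K : ClosureOperator P, (∀ i x, H i x ≤ K x) → ∀ x, J x ≤ K x) := by
  set S := ⨆ i, Setoid.ker ⇑(H i)
  have S_closure (i : ι) (x : P) : S x (H i x) :=
    (le_iSup (fun i => Setoid.ker ⇑(H i)) i) (show H i x = H i (H i x) by
      rw [(H i).idempotent])
  have le_J (x : P) : x ≤ J x := (hJ x).2 x (S.refl x)
  have J_J_le (x : P) : J (J x) ≤ J x :=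
    (hJ x).2 _ (S.trans (hJ x).1 (hJ (J x)).1)
  have closure_J_le (i : ι) (x : P) : H i (J x) ≤ J x :=
    (hJ x).2 _ (S.trans (hJ x).1 (S_closure i (J x)))
  let T : Setoid P := Setoid.ker fun x => {y | x ≤ J y}
  have S_le_T : S ≤ T := by
    have ker_le {i : ι} {a b : P} (hab : H i a = H i b) (y : P) (hy : a ≤ J y) : b ≤ J y :=
      calc b ≤ H i b := (H i).le_closure b
        _ = H i a := hab.symm
        _ ≤ H i (J y) := (H i).monotone hy
        _ ≤ J y := closure_J_le i y
    refine iSup_le fun i a b (hab : H i a = H i b) => ?_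
    exact Set.ext fun y => ⟨ker_le hab y, ker_le hab.symm y⟩
  refine ⟨le_J, fun x y hxy => ?_, fun x => le_antisymm (J_J_le x) (le_J _),
    fun i x => (hJ x).2 _ (S_closure i x), fun K hK x => ?_⟩
  · exact (Set.ext_iff.mp (S_le_T (hJ x).1) y).mp (hxy.trans (le_J y))
  · have S_le_ker : S ≤ Setoid.ker ⇑K := by
      have K_closure (i : ι) (a : P) : K (H i a) = K a :=
        le_antisymm ((K.monotone (hK i a)).trans_eq (K.idempotent a))
          (K.monotone ((H i).le_closure a))
      refine iSup_le fun i a b (hab : H i a = H i b) => ?_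
      change K a = K b
      rw [← K_closure i a, hab, K_closure]
    exact (K.le_closure (J x)).trans_eq (S_le_ker (hJ x).1).symm
end

section
/- Let P be a finite partial order with a greatest element. Then the following are equivalent: (1) for every pair of closure relations H, K on P, every equivalence class of the meet, in the lattice of equivalence relations on P, of the equivalence relations induced by H and K has a greatest element in P (equivalently, the lattice of closure relations on P is a sublattice of the partition lattice of P); (2) the poset obtained from P by adjoining a new least element (WithBot P) is a lattice. -/
open Classical in
/-- The closure operator on a poset with top whose closed elements are `a` and `⊤`. -/
noncomputable def ClosureOperator.toPrincipal {P : Type*} [PartialOrder P] [OrderTop P] (a : P) :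
    ClosureOperator P :=
  ClosureOperator.mk' (fun x => if x ≤ a then a else ⊤)
    (fun x y hxy => by
      dsimp only
      split_ifs with hx hy
      · exact le_rfl
      · exact le_top
      · exact absurd (hxy.trans ‹_›) hx
      · exact le_rfl)
    (fun x => by
      split_ifs with hx
      · exact hx
      · exact le_top)
    (fun x => by
      by_cases hx : x ≤ a
      · simp [hx]
      · simp [hx])

theorem ClosureOperator.toPrincipal_eq_iff {P : Type*} [PartialOrder P] [OrderTop P] {a x : P} :
    ClosureOperator.toPrincipal a x = a ↔ x ≤ a :=
  ⟨fun h => ((ClosureOperator.toPrincipal a).le_closure x).trans_eq h, fun h => if_pos h⟩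

theorem Set.Finite.exists_isGLB_of_pair {α : Type*} [PartialOrder α] [OrderTop α]
    (hpair : ∀ a b : α, ∃ d, IsGLB {a, b} d) {s : Set α} (hs : s.Finite) : ∃ d, IsGLB s d := by
  induction s, hs using Set.Finite.induction_on with
  | empty => exact ⟨⊤, isGLB_empty⟩
  | @insert a s _ _ ih =>
    obtain ⟨d, hd⟩ := ih
    obtain ⟨c, hc⟩ := hpair a d
    refine ⟨c, isGLB_iff_le_iff.2 fun x => ?_⟩
    rw [isGLB_iff_le_iff.1 hc x, lowerBounds_insert, lowerBounds_insert, lowerBounds_singleton]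
    simp [isGLB_iff_le_iff.1 hd x]

theorem Finite.exists_isLUB_of_exists_isGLB_pair {α : Type*} [PartialOrder α] [OrderTop α]
    [Finite α] (hpair : ∀ a b : α, ∃ d, IsGLB {a, b} d) (s : Set α) : ∃ c, IsLUB s c := by
  obtain ⟨c, hc⟩ := (Set.toFinite (upperBounds s)).exists_isGLB_of_pair hpair
  exact ⟨c, isGLB_upperBounds.1 hc⟩

theorem WithBot.exists_isGLB_pair {P : Type*} [PartialOrder P]
    (h : ∀ a b x : P, x ≤ a → x ≤ b → ∃ g, IsGLB {a, b} g) (a b : WithBot P) :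
    ∃ d, IsGLB {a, b} d := by
  by_cases hx : ∃ x : P, (x : WithBot P) ∈ lowerBounds {a, b}
  · obtain ⟨x, hx⟩ := hx
    have hxa : (x : WithBot P) ≤ a := hx (by simp)
    have hxb : (x : WithBot P) ≤ b := hx (by simp)
    obtain ⟨a, rfl, hxa'⟩ := WithBot.coe_le_iff.1 hxa
    obtain ⟨b, rfl, hxb'⟩ := WithBot.coe_le_iff.1 hxb
    obtain ⟨g, hg⟩ := h a b x hxa' hxb'
    refine ⟨g, isGLB_iff_le_iff.2 fun y => ?_⟩
    induction y with
    | bot => simp [lowerBounds_insert]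
    | coe y => simpa [lowerBounds_insert] using isGLB_iff_le_iff.1 hg y
  · refine ⟨⊥, fun _ _ => bot_le, fun y hy => ?_⟩
    induction y with
    | bot => exact le_rfl
    | coe y => exact absurd ⟨y, hy⟩ hx

/-- Let `P` be a finite poset with a greatest element.  Then every equivalence
class of the meet (intersection) of the equivalence relations induced by any two closure
relations `H`, `K` on `P` has a greatest element (i.e. the lattice of closure relations is a
sublattice of the partition lattice) if and only if `WithBot P`, the poset obtained by
adjoining a new least element to `P`, is a lattice (all binary joins and meets exist). -/
theorem sublattice_iff_withBot_lattice {P : Type*} [PartialOrder P] [OrderTop P] [Finite P] :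
    (∀ H K : ClosureOperator P, ∀ x : P,
      ∃ g : P, (H g = H x ∧ K g = K x) ∧ ∀ y : P, (H y = H x ∧ K y = K x) → y ≤ g) ↔
    (∀ a b : WithBot P,
      (∃ c : WithBot P, IsLUB {a, b} c) ∧ (∃ d : WithBot P, IsGLB {a, b} d)) := by
  constructor
  · intro h
    have hpair : ∀ a b : WithBot P, ∃ d, IsGLB {a, b} d := by
      refine WithBot.exists_isGLB_pair fun a b x hxa hxb => ?_
      obtain ⟨g, hg, hmax⟩ :=
        h (ClosureOperator.toPrincipal a) (ClosureOperator.toPrincipal b) x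
      simp only [ClosureOperator.toPrincipal_eq_iff.2 hxa, ClosureOperator.toPrincipal_eq_iff.2 hxb,
        ClosureOperator.toPrincipal_eq_iff] at hg hmax
      exact ⟨g, by simpa [lowerBounds_insert] using hg,
        fun y hy => hmax y ⟨hy (by simp), hy (by simp)⟩⟩
    exact fun a b => ⟨Finite.exists_isLUB_of_exists_isGLB_pair hpair _, hpair a b⟩
  · intro h H K x
    obtain ⟨d, hd⟩ := (h (H x) (K x)).2
    have le_d : ∀ y : P, y ≤ H x → y ≤ K x → (y : WithBot P) ≤ d := fun y hyH hyK =>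
      hd.2 (by simp [lowerBounds_insert, hyH, hyK])
    obtain ⟨g, rfl, hxg⟩ := WithBot.coe_le_iff.1 (le_d x (H.le_closure x) (K.le_closure x))
    have hgH : g ≤ H x := WithBot.coe_le_coe.1 (hd.1 (by simp))
    have hgK : g ≤ K x := WithBot.coe_le_coe.1 (hd.1 (by simp))
    refine ⟨g, ⟨?_, ?_⟩, fun y hy => WithBot.coe_le_coe.1 (le_d y ?_ ?_)⟩
    · exact le_antisymm (H.le_closure_iff.1 hgH) (H.monotone hxg)
    · exact le_antisymm (K.le_closure_iff.1 hgK) (K.monotone hxg)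
    · exact hy.1 ▸ H.le_closure y
    · exact hy.2 ▸ K.le_closure y
end

section
/- Let P be a finite partial order and let A ⊆ P be mlb-closed. Then A contains every maximal element of P, and for every x ∈ P the set A_{≥x} = {a ∈ A : x ≤ a} is nonempty and has a least element. -/
/-- `x` is a maximal lower bound of `B`: a lower bound of `B` maximal among lower bounds. -/
def IsMaxLowerBound {P : Type*} [PartialOrder P] (B : Set P) (x : P) : Prop :=
  x ∈ lowerBounds B ∧ ∀ z ∈ lowerBounds B, x ≤ z → x = z

/-- `A` is mlb-closed: every maximal lower bound of every subset of `A` lies in `A`. -/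
def MlbClosed {P : Type*} [PartialOrder P] (A : Set P) : Prop :=
  ∀ B ⊆ A, ∀ x : P, IsMaxLowerBound B x → x ∈ A

/-- For a finite poset `P` and an mlb-closed `A ⊆ P`, the set `A` contains every
maximal element of `P`, and for every `x ∈ P` the set `{a ∈ A : x ≤ a}` is nonempty and has a
least element. -/
theorem mlbClosed_least_above {P : Type*} [PartialOrder P] [Finite P]
    {A : Set P} (hA : MlbClosed A) :
    (∀ x : P, IsMax x → x ∈ A) ∧
    ∀ x : P, ({a ∈ A | x ≤ a}).Nonempty ∧ ∃ m : P, IsLeast {a ∈ A | x ≤ a} m := by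
  refine ⟨fun x hx => hA ∅ (Set.empty_subset A) x
    ⟨by simp, fun z _ hxz => hxz.antisymm (hx hxz)⟩, fun x => ?_⟩
  obtain ⟨m, hxm, hm⟩ := (Set.toFinite (lowerBounds {a ∈ A | x ≤ a})).exists_le_maximal
    (fun _ ha => ha.2 : x ∈ lowerBounds {a ∈ A | x ≤ a})
  have hmA : m ∈ A := hA _ (fun _ ha => ha.1) m ⟨hm.prop, fun _ hz hmz => hm.eq_of_le hz hmz⟩
  exact ⟨⟨m, hmA, hxm⟩, m, ⟨hmA, hxm⟩, hm.prop⟩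
end

section
/- Let P be a finite partial order. The map f sending a closure relation H on P to its set of closed elements f(H) = {x ∈ P : H(x) = x} is a bijection from the set of closure relations on P onto the set of mlb-closed subsets of P, and it is order-reversing in the strong sense: for closure relations H, K, one has H ≤ K pointwise if and only if f(K) ⊆ f(H). (Hence the lattice of closure relations on P is dually isomorphic to the lattice of mlb-closed subsets of P ordered by inclusion.) -/
/-- The pointwise partial order on closure relations. -/
instance ClosureOperator.instPartialOrder (α : Type*) [PartialOrder α] :
    PartialOrder (ClosureOperator α) :=
  PartialOrder.lift (fun H => (H : α → α)) DFunLike.coe_injective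

theorem IsMaxLowerBound.exists_ge {P : Type*} [PartialOrder P] [Finite P] {B : Set P} {x : P}
    (hx : x ∈ lowerBounds B) : ∃ m, x ≤ m ∧ IsMaxLowerBound B m := by
  obtain ⟨m, hxm, hm⟩ := (Set.toFinite (lowerBounds B)).exists_le_maximal hx
  exact ⟨m, hxm, hm.prop, fun z hz hmz => hm.eq_of_le hz hmz⟩

theorem MlbClosed.exists_isLeast {P : Type*} [PartialOrder P] [Finite P] {A : Set P}
    (hA : MlbClosed A) (x : P) : ∃ m, IsLeast {a ∈ A | x ≤ a} m := by
  obtain ⟨m, hxm, hm⟩ := IsMaxLowerBound.exists_ge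
    (show x ∈ lowerBounds {a ∈ A | x ≤ a} from fun _ ha => ha.2)
  exact ⟨m, ⟨hA _ (Set.sep_subset _ _) m hm, hxm⟩, hm.1⟩

theorem ClosureOperator.mlbClosed_fixedPoints {P : Type*} [PartialOrder P]
    (H : ClosureOperator P) : MlbClosed {x : P | H x = x} := by
  intro B hB x hx
  refine (hx.2 (H x) (fun b hb => ?_) (H.le_closure x)).symm
  exact (H.monotone (hx.1 hb)).trans_eq (hB hb)

theorem ClosureOperator.le_iff_fixedPoints_subset {P : Type*} [PartialOrder P]
    (H K : ClosureOperator P) : H ≤ K ↔ {x : P | K x = x} ⊆ {x : P | H x = x} := by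
  constructor
  · intro h x hx
    exact le_antisymm ((h x).trans_eq hx) (H.le_closure x)
  · intro h x
    have hK : H (K x) = K x := h (K.idempotent x)
    exact (H.monotone (K.le_closure x)).trans_eq hK

theorem MlbClosed.exists_closureOperator {P : Type*} [PartialOrder P] [Finite P] {A : Set P}
    (hA : MlbClosed A) : ∃ H : ClosureOperator P, {x : P | H x = x} = A := by
  choose f hf using hA.exists_isLeast
  refine ⟨ClosureOperator.ofPred f (· ∈ A) (fun x => (hf x).1.2) (fun x => (hf x).1.1)
    (fun x y hxy hy => (hf x).2 ⟨hy, hxy⟩), ?_⟩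
  ext x
  exact (ClosureOperator.isClosed_iff _).symm

/-- For a finite poset `P`, the map `H ↦ {x : H x = x}` is a bijection from
closure relations on `P` onto mlb-closed subsets of `P`, and `H ≤ K` pointwise iff the closed
set of `K` is contained in the closed set of `H`.  Hence the lattice of closure relations on
`P` is dually isomorphic to the lattice of mlb-closed subsets ordered by inclusion. -/
theorem closure_dual_iso_mlbClosed {P : Type*} [PartialOrder P] [Finite P] :
    (∀ H : ClosureOperator P, MlbClosed {x : P | H x = x}) ∧
    (∀ A : Set P, MlbClosed A → ∃! H : ClosureOperator P, {x : P | H x = x} = A) ∧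
    (∀ H K : ClosureOperator P,
      H ≤ K ↔ {x : P | K x = x} ⊆ {x : P | H x = x}) := by
  refine ⟨fun H => H.mlbClosed_fixedPoints, fun A hA => ?_,
    fun H K => H.le_iff_fixedPoints_subset K⟩
  obtain ⟨H, hH⟩ := hA.exists_closureOperator
  refine ⟨H, hH, fun K hK => le_antisymm ?_ ?_⟩
  · exact (K.le_iff_fixedPoints_subset H).2 (hH.trans hK.symm).subset
  · exact (H.le_iff_fixedPoints_subset K).2 (hK.trans hH.symm).subset
end

section
/- Let P be a finite partial order, let A ⊆ P be mlb-closed, and let x, y ∈ P be distinct elements with x ∉ A and y ∉ A. If x belongs to the mlb-closure of A ∪ {y}, then x ≤ y in P; in particular, y does not belong to the mlb-closure of A ∪ {x}. (Thus mlb-closure satisfies the anti-exchange axiom, so it is a convex closure on the set P.) -/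
/-- The mlb-closure of `A`: the intersection of all mlb-closed sets containing `A`. -/
def mlbClosure {P : Type*} [PartialOrder P] (A : Set P) : Set P :=
  ⋂₀ {C : Set P | MlbClosed C ∧ A ⊆ C}

/-- Adjoining a principal down-set to an mlb-closed set yields an mlb-closed set. -/
theorem MlbClosed.union_Iic {P : Type*} [PartialOrder P] {A : Set P} (hA : MlbClosed A) (y : P) :
    MlbClosed (A ∪ Set.Iic y) := by
  intro B hB z hz
  by_cases hBA : B ⊆ A
  · exact Or.inl (hA B hBA z hz)
  · obtain ⟨b, hb, hbA⟩ := Set.not_subset.mp hBA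
    exact Or.inr ((hz.1 hb).trans ((hB hb).resolve_left hbA))

/-- An element outside an mlb-closed set `A` but in the mlb-closure of `A ∪ {y}` lies below `y`. -/
theorem MlbClosed.le_of_mem_mlbClosure_union_singleton {P : Type*} [PartialOrder P] {A : Set P}
    (hA : MlbClosed A) {x y : P} (hx : x ∉ A) (h : x ∈ mlbClosure (A ∪ {y})) : x ≤ y :=
  (h _ ⟨hA.union_Iic y, Set.union_subset_union_right A (by simp)⟩).resolve_left hx

/-- Anti-exchange.  For a finite poset `P`, an mlb-closed set `A` and distinct
`x, y ∉ A`: if `x` lies in the mlb-closure of `A ∪ {y}` then `x ≤ y`; in particular `y` does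
not lie in the mlb-closure of `A ∪ {x}`.  Hence mlb-closure is a convex closure on `P`. -/
theorem mlbClosure_antiExchange {P : Type*} [PartialOrder P] [Finite P]
    {A : Set P} (hA : MlbClosed A) {x y : P} (hxy : x ≠ y)
    (hx : x ∉ A) (hy : y ∉ A) (h : x ∈ mlbClosure (A ∪ {y})) :
    x ≤ y ∧ y ∉ mlbClosure (A ∪ {x}) := by
  have hle := hA.le_of_mem_mlbClosure_union_singleton hx h
  exact ⟨hle, fun h' => hxy (hle.antisymm (hA.le_of_mem_mlbClosure_union_singleton hy h'))⟩
end

section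
/- Let P be a finite partial order and let H, K be closure relations on P with closed sets A_H = {x : H(x) = x} and A_K = {x : K(x) = x}. Then K covers H in the pointwise order on closure relations (H < K and no closure relation lies strictly between them) if and only if A_K ⊆ A_H and A_H \ A_K has exactly one element. Consequently, the lattice of closure relations on P is graded, with the rank of H equal to card(P) − card(A_H). -/
namespace ClosureOperator

variable {P : Type*} [PartialOrder P] {H K : ClosureOperator P}

theorem le_iff_closed_subset : H ≤ K ↔ {x : P | K x = x} ⊆ {x : P | H x = x} := by
  constructor
  · intro h x hx
    exact ((h x).trans_eq hx).antisymm (H.le_closure x)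
  · intro h x
    have hK : H (K x) = K x := h (K.idempotent x)
    exact (H.monotone (K.le_closure x)).trans_eq hK

theorem lt_iff_closed_ssubset : H < K ↔ {x : P | K x = x} ⊂ {x : P | H x = x} := by
  rw [lt_iff_le_not_ge, le_iff_closed_subset, le_iff_closed_subset]
  rfl

open Classical in
/-- A maximal element `a` among those closed for `H` but not for `K` can be removed from the
closed elements of `H`, by sending it to `K a`. -/
theorem exists_closed_eq_sdiff_singleton (hHK : H ≤ K) {a : P} (ha : K a ≠ a)
    (hmax : ∀ b, H b = b → a < b → K b = b) :
    ∃ L : ClosureOperator P, {x : P | L x = x} = {x : P | H x = x} \ {a} := by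
  let f : P → P := fun x => if H x = a then K a else H x
  have hf_closed (y : P) : H (f y) = f y := by
    by_cases hy : H y = a
    · simpa [f, hy] using le_iff_closed_subset.1 hHK (K.idempotent a)
    · simp [f, hy]
  have hf_ne (y : P) : f y ≠ a := by
    by_cases hy : H y = a <;> simp [f, hy, ha]
  have hf_le (x : P) : H x ≤ f x := by
    by_cases hx : H x = a
    · simpa [f, hx] using K.le_closure a
    · simp [f, hx]
  have hf_min ⦃x y : P⦄ (hxy : x ≤ f y) : f x ≤ f y := by
    have hHx : H x ≤ f y := (H.monotone hxy).trans_eq (hf_closed y)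
    by_cases hx : H x = a
    · have hay : a ≤ f y := hx ▸ hHx
      have hK := hmax _ (hf_closed y) (hay.lt_of_ne (hf_ne y).symm)
      simpa [f, hx] using (K.monotone hay).trans_eq hK
    · simpa only [f, if_neg hx] using hHx
  refine ⟨mk₂ f (fun x => (H.le_closure x).trans (hf_le x)) hf_min, Set.ext fun x => ?_⟩
  change f x = x ↔ H x = x ∧ x ≠ a
  constructor
  · intro hx
    exact ⟨hx ▸ hf_closed x, hx ▸ hf_ne x⟩
  · rintro ⟨hx, hxa⟩
    simp [f, hx, hxa]

theorem covBy_iff_ncard_closed_sdiff [Finite P] :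
    H ⋖ K ↔ {x : P | K x = x} ⊆ {x : P | H x = x} ∧
      ({x : P | H x = x} \ {x : P | K x = x}).ncard = 1 := by
  constructor
  · intro hcov
    have hle := hcov.lt.le
    refine ⟨le_iff_closed_subset.1 hle, ?_⟩
    obtain ⟨a, ⟨ha, ha'⟩, hmax⟩ :=
      (Set.toFinite ({x : P | H x = x} \ {x : P | K x = x})).exists_maximal
        (Set.sdiff_nonempty.2 (lt_iff_closed_ssubset.1 hcov.lt).2)
    obtain ⟨L, hL⟩ := exists_closed_eq_sdiff_singleton hle ha' fun b hb hab => by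
      by_contra hb'
      exact (hmax ⟨hb, hb'⟩ hab.le).not_gt hab
    have hHL : H < L := by
      rw [lt_iff_closed_ssubset, hL]
      exact Set.sdiff_singleton_ssubset.2 ha
    have hLK : L ≤ K := by
      rw [le_iff_closed_subset, hL]
      exact Set.subset_sdiff_singleton (le_iff_closed_subset.1 hle) ha'
    obtain rfl : L = K := hLK.eq_of_not_lt (hcov.2 hHL)
    rw [hL, Set.sdiff_sdiff_cancel_left (Set.singleton_subset_iff.2 ha), Set.ncard_singleton]
  · rintro ⟨hsub, hcard⟩
    have hsum := Set.ncard_sdiff_add_ncard_of_subset hsub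
    refine ⟨lt_iff_closed_ssubset.2 (hsub.ssubset_of_ne fun h => ?_), fun L hHL hLK => ?_⟩
    · simp [h] at hcard
    · have h₁ := Set.ncard_lt_ncard (lt_iff_closed_ssubset.1 hHL)
      have h₂ := Set.ncard_lt_ncard (lt_iff_closed_ssubset.1 hLK)
      omega

end ClosureOperator

/-- For a finite poset `P` and closure relations `H`, `K` with closed sets
`A_H`, `A_K`: `K` covers `H` in the pointwise order iff `A_K ⊆ A_H` and `A_H \ A_K` is a
singleton.  Consequently the lattice of closure relations is graded, the rank of `H` being
`card P − card A_H` (so corank drops by one along covers). -/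
theorem closure_covBy_iff {P : Type*} [PartialOrder P] [Finite P] :
    (∀ H K : ClosureOperator P,
      H ⋖ K ↔ ({x : P | K x = x} ⊆ {x : P | H x = x} ∧
        ({x : P | H x = x} \ {x : P | K x = x}).ncard = 1)) ∧
    (∀ H K : ClosureOperator P, H ⋖ K →
      Nat.card P - ({x : P | K x = x}).ncard
        = (Nat.card P - ({x : P | H x = x}).ncard) + 1) := by
  refine ⟨fun H K => ClosureOperator.covBy_iff_ncard_closed_sdiff, fun H K hcov => ?_⟩
  obtain ⟨hsub, hcard⟩ := ClosureOperator.covBy_iff_ncard_closed_sdiff.1 hcov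
  have hsum := Set.ncard_sdiff_add_ncard_of_subset hsub
  have hle := Set.ncard_le_card {x : P | H x = x}
  omega
end

section
/- Let P be a finite partial order. A closure relation H on P is an atom of the lattice of closure relations (i.e., H covers the identity closure) if and only if there is exactly one element x ∈ P with H(x) ≠ x, and for such H the element H(x) covers x and is the unique element of P covering x. Moreover, for every x ∈ P covered by a unique element y, the map fixing all elements except x and sending x to y is a closure relation and an atom; hence the number of atoms of the lattice of closure relations on P equals the number of elements of P covered by exactly one element. -/
open Classical

namespace ClosureOperator

variable {P : Type*} [PartialOrder P]

/-- The closure operator sending `x` to `y` and fixing every other element, where `y` is the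
least element strictly above `x`. -/
noncomputable def moveOne (x y : P) (hxy : x < y) (h : ∀ z, x < z → y ≤ z) :
    ClosureOperator P :=
  ClosureOperator.mk' (fun w => if w = x then y else w)
    (by
      intro a b hab
      by_cases ha : a = x
      · subst ha
        by_cases hb : b = a
        · simp [hb]
        · simpa [hb] using h b (lt_of_le_of_ne hab (Ne.symm hb))
      · by_cases hb : b = x
        · subst hb
          simpa [ha] using hab.trans hxy.le
        · simpa [ha, hb] using hab)
    (by
      intro w
      by_cases hw : w = x
      · simpa [hw] using hxy.le
      · simp [hw])
    (by
      intro w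
      by_cases hw : w = x
      · simp [hw, hxy.ne']
      · simp [hw])

theorem moveOne_apply (x y : P) (hxy : x < y) (h : ∀ z, x < z → y ≤ z) (w : P) :
    moveOne x y hxy h w = if w = x then y else w := rfl

theorem id_lt_iff (H : ClosureOperator P) : ClosureOperator.id P < H ↔ ∃ x, H x ≠ x := by
  have hle : ClosureOperator.id P ≤ H := fun x => H.le_closure x
  rw [hle.lt_iff_ne, Ne, DFunLike.ext_iff, not_forall]
  exact exists_congr fun x => not_congr eq_comm

theorem id_covBy_of_existsUnique {H : ClosureOperator P} (hH : ∃! x, H x ≠ x) :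
    ClosureOperator.id P ⋖ H := by
  obtain ⟨x, hx, huniq⟩ := hH
  have hfix : ∀ w, w ≠ x → H w = w := fun w hw => by_contra fun h => hw (huniq w h)
  refine ⟨(id_lt_iff H).2 ⟨x, hx⟩, fun K hK hKH => hKH.not_ge fun w => ?_⟩
  have hKle : ∀ w, K w ≤ H w := hKH.le
  change H w ≤ K w
  by_cases hw : w = x
  · subst hw
    obtain ⟨v, hv⟩ := (id_lt_iff K).1 hK
    have hvw : v = w := by_contra fun h =>
      hv (le_antisymm ((hKle v).trans_eq (hfix v h)) (K.le_closure v))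
    subst hvw
    exact (H.monotone (K.le_closure v)).trans_eq (hfix _ hv)
  · rw [hfix w hw]
    exact K.le_closure w

theorem existsUnique_of_id_covBy [Finite P] {H : ClosureOperator P}
    (hH : ClosureOperator.id P ⋖ H) : ∃! x, H x ≠ x := by
  obtain ⟨x, hx⟩ := (Set.toFinite {x | H x ≠ x}).exists_maximal ((id_lt_iff H).1 hH.lt)
  have hmoved : H x ≠ x := hx.prop
  have habove : ∀ z, x < z → H x ≤ z := fun z hz =>
    (H.monotone hz.le).trans_eq (by_contra fun h => hx.not_gt h hz)
  let K := moveOne x (H x) (lt_of_le_of_ne (H.le_closure x) hmoved.symm) habove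
  have hK : ∀ w, K w = if w = x then H x else w := moveOne_apply _ _ _ _
  have hKH : K ≤ H := by
    intro w
    change K w ≤ H w
    rw [hK]
    split_ifs with hw
    · rw [hw]
    · exact H.le_closure w
  have hidK : ClosureOperator.id P < K := (id_lt_iff K).2 ⟨x, by simpa [hK] using hmoved⟩
  have hEq : K = H := hKH.eq_of_not_lt (hH.2 hidK)
  refine ⟨x, hmoved, fun w hw => by_contra fun hwx => hw ?_⟩
  rw [← hEq, hK, if_neg hwx]

theorem covBy_and_unique_of_existsUnique {H : ClosureOperator P} (hH : ∃! x, H x ≠ x) {x : P}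
    (hx : H x ≠ x) : x ⋖ H x ∧ ∀ z, x ⋖ z → z = H x := by
  have hlt : x < H x := lt_of_le_of_ne (H.le_closure x) hx.symm
  have habove : ∀ z, x < z → H x ≤ z := fun z hz =>
    (H.monotone hz.le).trans_eq (by_contra fun h => hz.ne' (hH.unique h hx))
  exact ⟨⟨hlt, fun z hz hzH => hzH.not_ge (habove z hz)⟩, fun z hz =>
    ((habove z hz.lt).eq_of_not_lt (hz.2 hlt)).symm⟩

theorem exists_id_covBy_of_unique_covBy [Finite P] {x y : P} (hxy : x ⋖ y)
    (huniq : ∀ z, x ⋖ z → z = y) :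
    ∃ H : ClosureOperator P,
      (∀ w, H w = if w = x then y else w) ∧ ClosureOperator.id P ⋖ H := by
  have habove : ∀ z, x < z → y ≤ z := fun z hz => by
    obtain ⟨c, hc, hcz⟩ := exists_covBy_le_of_lt hz
    exact huniq c hc ▸ hcz
  refine ⟨moveOne x y hxy.lt habove, moveOne_apply _ _ _ _, id_covBy_of_existsUnique ⟨x, ?_, ?_⟩⟩
  · simpa [moveOne_apply] using hxy.lt.ne'
  · intro w hw
    by_contra h
    exact hw (by rw [moveOne_apply, if_neg h])

theorem card_id_covBy [Finite P] :
    Nat.card {H : ClosureOperator P // ClosureOperator.id P ⋖ H}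
      = Nat.card {x : P // ∃! y : P, x ⋖ y} := by
  choose moved hmoved huniq using
    fun H : {H : ClosureOperator P // ClosureOperator.id P ⋖ H} => existsUnique_of_id_covBy H.2
  have hcov := fun H => covBy_and_unique_of_existsUnique ⟨moved H, hmoved H, huniq H⟩ (hmoved H)
  refine Nat.card_eq_of_bijective
    (fun H => ⟨moved H, H.1 (moved H), (hcov H).1, (hcov H).2⟩) ⟨fun H K hHK => ?_, ?_⟩
  · have hx : moved H = moved K := congrArg Subtype.val hHK
    refine Subtype.ext (DFunLike.ext _ _ fun w => ?_)
    by_cases hw : w = moved H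
    · subst hw
      exact (hcov K).2 _ (hx ▸ (hcov H).1) |>.trans (by rw [hx])
    · have hH : H.1 w = w := by_contra fun h => hw (huniq H w h)
      have hK : K.1 w = w := by_contra fun h => hw ((huniq K w h).trans hx.symm)
      rw [hH, hK]
  · rintro ⟨x, y, hxy, hy⟩
    obtain ⟨H, hHw, hH⟩ := exists_id_covBy_of_unique_covBy hxy hy
    have hHx : H x ≠ x := by simpa [hHw] using hxy.lt.ne'
    exact ⟨⟨H, hH⟩, Subtype.ext (huniq ⟨H, hH⟩ x hHx).symm⟩

end ClosureOperator

/-- For a finite poset `P`: a closure relation `H` is an atom of the lattice of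
closure relations (covers the identity closure) iff exactly one `x ∈ P` has `H x ≠ x`; for
such `H` and `x`, `H x` covers `x` and is the unique element covering `x`.  Conversely, for any
`x` covered by a unique element `y`, the map fixing everything except `x` and sending `x` to
`y` is a closure relation and an atom.  Hence the number of atoms equals the number of
elements of `P` covered by exactly one element. -/
theorem closureLattice_atoms {P : Type*} [PartialOrder P] [Finite P] :
    (∀ H : ClosureOperator P, (ClosureOperator.id P ⋖ H) ↔ ∃! x : P, H x ≠ x) ∧
    (∀ H : ClosureOperator P, (ClosureOperator.id P ⋖ H) → ∀ x : P, H x ≠ x →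
      (x ⋖ H x ∧ ∀ z : P, x ⋖ z → z = H x)) ∧
    (∀ x y : P, (x ⋖ y) → (∀ z : P, x ⋖ z → z = y) →
      ∃ H : ClosureOperator P,
        (∀ w : P, H w = if w = x then y else w) ∧ ClosureOperator.id P ⋖ H) ∧
    (Nat.card {H : ClosureOperator P // ClosureOperator.id P ⋖ H}
      = Nat.card {x : P // ∃! y : P, x ⋖ y}) := by
  exact ⟨fun H => ⟨ClosureOperator.existsUnique_of_id_covBy,
      ClosureOperator.id_covBy_of_existsUnique⟩,
    fun H hH x hx => ClosureOperator.covBy_and_unique_of_existsUnique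
      (ClosureOperator.existsUnique_of_id_covBy hH) hx,
    fun x y => ClosureOperator.exists_id_covBy_of_unique_covBy,
    ClosureOperator.card_id_covBy⟩
end

section
/- Let P be a finite partial order, let L be the lattice of closure relations on P ordered pointwise, let μ denote the Möbius function of L (over ℤ), let I be the identity closure (the least element of L), let s be the number of elements of P covered by exactly one element, and let m be the cardinality of the mlb-closure of the set of maximal elements of P. Then, as polynomials in λ, the characteristic polynomial of L satisfies Σ_{H ∈ L} μ(I, H) · λ^{card({x : H(x) = x}) − m} = (λ − 1)^s · λ^{card(P) − m − s}. -/
namespace ClosureOperator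

variable {P : Type*} [PartialOrder P]

theorem le_iff_forall_apply_eq {H K : ClosureOperator P} :
    H ≤ K ↔ ∀ x, K x = x → H x = x := by
  constructor
  · intro h x hx
    exact le_antisymm ((h x).trans_eq hx) (H.le_closure x)
  · intro h x
    have hK := h (K x) (K.idempotent x)
    exact (H.monotone (K.le_closure x)).trans_eq hK

/-- A set of elements each of which has a unique cover is the set of non-closed elements of some
closure operator. -/
theorem exists_forall_apply_ne_iff_mem [Finite P] (T : Set P) (hT : ∀ x ∈ T, ∃! y, x ⋖ y) :
    ∃ H : ClosureOperator P, ∀ x, H x ≠ x ↔ x ∈ T := by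
  have key : ∀ x : P, ∃ c, IsLeast {c | c ∉ T ∧ x ≤ c} c := by
    intro x
    induction x using WellFoundedGT.induction with
    | ind x ih =>
      by_cases hx : x ∈ T
      · obtain ⟨y, hxy, hy⟩ := hT x hx
        obtain ⟨c, ⟨hcT, hyc⟩, hc⟩ := ih y hxy.lt
        refine ⟨c, ⟨hcT, hxy.le.trans hyc⟩, fun d ⟨hdT, hxd⟩ => hc ⟨hdT, ?_⟩⟩
        have hlt : x < d := lt_of_le_of_ne hxd (by rintro rfl; exact hdT hx)
        obtain ⟨z, hxz, hzd⟩ := exists_covBy_le_of_lt hlt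
        exact (hy z hxz).ge.trans hzd
      · exact ⟨x, ⟨hx, le_rfl⟩, fun d hd => hd.2⟩
  choose f hf using key
  refine ⟨ClosureOperator.mk₂ f (fun x => (hf x).1.2)
    (fun x y h => (hf x).2 ⟨(hf y).1.1, h⟩), fun x => ?_⟩
  change f x ≠ x ↔ x ∈ T
  constructor
  · intro h
    by_contra hx
    exact h (le_antisymm ((hf x).2 ⟨hx, le_rfl⟩) (hf x).1.2)
  · intro hx h
    exact (hf x).1.1 (h.symm ▸ hx)

theorem exists_existsUnique_covBy_of_ne_id [Finite P] {H : ClosureOperator P}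
    (hH : ∃ x, H x ≠ x) : ∃ x, H x ≠ x ∧ ∃! y, x ⋖ y := by
  obtain ⟨x, hx, hmax⟩ := (Set.toFinite {x | H x ≠ x}).exists_maximal hH
  have hlt : x < H x := lt_of_le_of_ne (H.le_closure x) (Ne.symm hx)
  have hle : ∀ z, x < z → H x ≤ z := by
    intro z hz
    have hHz : H z = z := by
      by_contra h
      exact hz.not_ge (hmax h hz.le)
    exact (H.monotone hz.le).trans_eq hHz
  have hcov : x ⋖ H x := ⟨hlt, fun z hxz hz => hz.not_ge (hle z hxz)⟩
  refine ⟨x, hx, H x, hcov, fun z hz => ?_⟩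
  by_contra hne
  exact hz.2 hlt (lt_of_le_of_ne (hle z hz.lt) (Ne.symm hne))

open scoped Classical in
/-- The elements of a finite poset that are not closed. -/
noncomputable def nonClosed [Fintype P] (H : ClosureOperator P) : Finset P :=
  {x | H x ≠ x}

section Fintype

variable [Fintype P]

@[simp]
theorem mem_nonClosed {H : ClosureOperator P} {x : P} : x ∈ H.nonClosed ↔ H x ≠ x := by
  simp [nonClosed]

theorem nonClosed_subset_nonClosed {H K : ClosureOperator P} :
    H.nonClosed ⊆ K.nonClosed ↔ H ≤ K := by
  simp only [le_iff_forall_apply_eq, Finset.subset_iff, mem_nonClosed, not_imp_not, ne_eq]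

theorem nonClosed_injective : Function.Injective (nonClosed : ClosureOperator P → Finset P) :=
  fun _ _ h => le_antisymm (nonClosed_subset_nonClosed.1 h.subset)
    (nonClosed_subset_nonClosed.1 h.symm.subset)

open scoped Classical in
theorem sum_nonClosed_subset [Fintype (ClosureOperator P)] {M : Type*} [AddCommMonoid M]
    (S : Finset P) (hS : ∀ x ∈ S, ∃! y, x ⋖ y) (f : Finset P → M) :
    ∑ H : ClosureOperator P with H.nonClosed ⊆ S, f H.nonClosed = ∑ T ∈ S.powerset, f T := by
  refine Finset.sum_bij (fun H _ => H.nonClosed) ?_ ?_ ?_ ?_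
  · intro H hH
    simpa using hH
  · exact fun H _ K _ h => nonClosed_injective h
  · intro T hT
    rw [Finset.mem_powerset] at hT
    obtain ⟨H, hH⟩ := exists_forall_apply_ne_iff_mem (T : Set P) (fun x hx => hS x (hT hx))
    have hHT : H.nonClosed = T := by
      ext x
      simpa using hH x
    exact ⟨H, by simpa [hHT] using hT, hHT⟩
  · exact fun _ _ => rfl

open scoped Classical in
/-- The Möbius function of the lattice of closure operators is supported on the joins of atoms. -/
theorem moebius_eq [Fintype (ClosureOperator P)] (μ : ClosureOperator P → ℤ)
    (hμ1 : μ (ClosureOperator.id P) = 1)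
    (hμ : ∀ H : ClosureOperator P, ClosureOperator.id P < H →
      ∑ᶠ z ∈ {z : ClosureOperator P | z ≤ H}, μ z = 0)
    (A : Finset P) (hA : ∀ x, x ∈ A ↔ ∃! y, x ⋖ y) (H : ClosureOperator P) :
    μ H = if H.nonClosed ⊆ A then (-1) ^ H.nonClosed.card else 0 := by
  induction H using WellFoundedLT.induction with
  | ind H ih =>
    by_cases hH : ∃ x, H x ≠ x
    · have hlt : ClosureOperator.id P < H := by
        refine lt_of_le_of_ne (le_iff_forall_apply_eq.2 fun _ _ => rfl) ?_
        rintro rfl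
        obtain ⟨x, hx⟩ := hH
        exact hx rfl
      have hsum := hμ H hlt
      rw [finsum_mem_eq_finite_toFinset_sum _ (Set.toFinite _)] at hsum
      have hmem : H ∈ (Set.toFinite {z : ClosureOperator P | z ≤ H}).toFinset := by simp
      have hg : ∑ z ∈ (Set.toFinite {z : ClosureOperator P | z ≤ H}).toFinset,
          (if z.nonClosed ⊆ A then (-1 : ℤ) ^ z.nonClosed.card else 0) = 0 := by
        rw [← Finset.sum_filter]
        have hset : {z ∈ (Set.toFinite {z : ClosureOperator P | z ≤ H}).toFinset |
            z.nonClosed ⊆ A} =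
            Finset.univ.filter fun z : ClosureOperator P => z.nonClosed ⊆ H.nonClosed ∩ A := by
          ext z
          simp [Finset.subset_inter_iff, nonClosed_subset_nonClosed]
        rw [hset, sum_nonClosed_subset (H.nonClosed ∩ A)
          (fun x hx => (hA x).1 (Finset.mem_inter.1 hx).2) (fun T => (-1 : ℤ) ^ T.card)]
        apply Finset.sum_powerset_neg_one_pow_card_of_nonempty
        obtain ⟨x, hx, hxA⟩ := exists_existsUnique_covBy_of_ne_id hH
        exact ⟨x, by simp [hx, (hA x).2 hxA]⟩
      rw [← Finset.add_sum_erase _ _ hmem] at hsum hg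
      rw [Finset.sum_congr rfl fun z hz => ih z ?_] at hsum
      · linarith
      · have hz' := Finset.mem_erase.1 hz
        exact lt_of_le_of_ne (by simpa using hz'.2) hz'.1
    · push Not at hH
      have hid : H = ClosureOperator.id P := DFunLike.ext _ _ hH
      have hempty : H.nonClosed = ∅ := by
        ext x
        simp [hH]
      simp [hempty, hid ▸ hμ1]

end Fintype

end ClosureOperator

theorem mlbClosure_isMax_subset {P : Type*} [PartialOrder P] [Finite P] :
    mlbClosure {x : P | IsMax x} ⊆ {x : P | ∃! y, x ⋖ y}ᶜ := by
  refine Set.sInter_subset_of_mem ⟨fun B hB x hx hxA => ?_, fun x hx hxA => ?_⟩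
  · obtain ⟨y, hxy, hy⟩ := hxA
    refine hxy.ne (hx.2 y (fun b hb => ?_) hxy.le)
    have hlt : x < b := lt_of_le_of_ne (hx.1 hb) (by rintro rfl; exact hB hb ⟨y, hxy, hy⟩)
    obtain ⟨z, hxz, hzb⟩ := exists_covBy_le_of_lt hlt
    exact (hy z hxz).ge.trans hzb
  · obtain ⟨y, hxy, -⟩ := hxA
    exact hx.not_lt hxy.lt

/-- the characteristic polynomial of the lattice `L` of closure relations on a
finite poset `P` is `(λ - 1)^s · λ^(card P - m - s)`, where `μ` is the Möbius function of `L`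
(in one argument, based at the identity closure, its least element), `s` is the number of
elements of `P` covered by exactly one element, and `m` is the cardinality of the mlb-closure
of the set of maximal elements of `P`. -/
theorem closureLattice_charPoly {P : Type*} [PartialOrder P] [Finite P]
    (μ : ClosureOperator P → ℤ)
    (hμ1 : μ (ClosureOperator.id P) = 1)
    (hμ : ∀ H : ClosureOperator P, ClosureOperator.id P < H →
      ∑ᶠ z ∈ {z : ClosureOperator P | z ≤ H}, μ z = 0)
    (s m : ℕ)
    (hs : s = Nat.card {x : P // ∃! y : P, x ⋖ y})
    (hm : m = (mlbClosure {x : P | IsMax x}).ncard) :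
    ∑ᶠ H : ClosureOperator P,
        Polynomial.C (μ H) * Polynomial.X ^ (({x : P | H x = x}).ncard - m)
      = (Polynomial.X - 1) ^ s * Polynomial.X ^ (Nat.card P - m - s) := by
  classical
  have := Fintype.ofFinite P
  have : Finite (ClosureOperator P) := DFunLike.finite _
  have := Fintype.ofFinite (ClosureOperator P)
  set A : Finset P := {x | ∃! y, x ⋖ y} with hAdef
  have hA : ∀ x, x ∈ A ↔ ∃! y, x ⋖ y := by simp [hAdef]
  have hsA : s = A.card := by
    rw [hs, Nat.card_eq_fintype_card, Fintype.card_subtype]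
  have hms : m + s ≤ Nat.card P := by
    have hle := Set.ncard_le_ncard (mlbClosure_isMax_subset (P := P)) (Set.toFinite _)
    have hco : ({x : P | ∃! y, x ⋖ y}ᶜ : Set P) = ((Aᶜ : Finset P) : Set P) := by
      ext x
      simp [hA]
    rw [hco, Set.ncard_coe_finset, Finset.card_compl] at hle
    have hAle := A.card_le_univ
    rw [Nat.card_eq_fintype_card]
    omega
  have hclosed : ∀ H : ClosureOperator P,
      {x : P | H x = x}.ncard = Nat.card P - H.nonClosed.card := by
    intro H
    have hco : {x : P | H x = x} = ((H.nonClosedᶜ : Finset P) : Set P) := by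
      ext x
      simp
    rw [hco, Set.ncard_coe_finset, Finset.card_compl, Nat.card_eq_fintype_card]
  rw [finsum_eq_sum_of_fintype]
  simp_rw [ClosureOperator.moebius_eq μ hμ1 hμ A hA, hclosed, apply_ite Polynomial.C, ite_mul,
    Polynomial.C_0, zero_mul]
  rw [← Finset.sum_filter, ClosureOperator.sum_nonClosed_subset A (fun x hx => (hA x).1 hx)
    (fun T => Polynomial.C ((-1 : ℤ) ^ T.card) *
      (Polynomial.X : Polynomial ℤ) ^ (Nat.card P - T.card - m)),
    sub_eq_neg_add, hsA, ← Finset.sum_pow_mul_eq_add_pow, Finset.sum_mul]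
  refine Finset.sum_congr rfl fun T hT => ?_
  have hTA := Finset.card_le_card (Finset.mem_powerset.1 hT)
  rw [mul_assoc, ← pow_add]
  congr 2
  · simp
  · omega
end

section
/- Let P be a finite partial order and let H be a closure relation on P satisfying the cover property. Then H is a modular element of the lattice of closure relations on P: for all closure relations K ≤ K', if H ⊔ K = H ⊔ K' and H ⊓ K = H ⊓ K', then K = K'. -/
/-- `H` has the cover property: whenever `y` covers `x` and `H x ≠ x`, then `H y = H x`. -/
def CoverProperty {P : Type*} [PartialOrder P] (H : ClosureOperator P) : Prop :=
  ∀ x y : P, x ⋖ y → H x ≠ x → H y = H x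

namespace ClosureOperator

variable {P : Type*} [PartialOrder P]

/-- In a finite poset there is a least element above `w` closed under both `H` and `K`. -/
theorem exists_least_common_closed [Finite P] (H K : ClosureOperator P) (w : P) :
    ∃ u, w ≤ u ∧ (H u = u ∧ K u = u) ∧ ∀ v, w ≤ v → H v = v → K v = v → u ≤ v := by
  induction w using (wellFounded_gt (α := P)).induction with
  | _ w ih =>
    have step (F : ClosureOperator P) (hF : F w ≠ w)
        (hclosed : ∀ v, H v = v → K v = v → F v = v) :
        ∃ u, w ≤ u ∧ (H u = u ∧ K u = u) ∧ ∀ v, w ≤ v → H v = v → K v = v → u ≤ v := by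
      obtain ⟨u, hwu, hu, hmin⟩ := ih (F w) (lt_of_le_of_ne (F.le_closure w) hF.symm)
      refine ⟨u, (F.le_closure w).trans hwu, hu, fun v hv hHv hKv => hmin v ?_ hHv hKv⟩
      exact (F.monotone hv).trans_eq (hclosed v hHv hKv)
    by_cases hHw : H w = w
    · by_cases hKw : K w = w
      · exact ⟨w, le_rfl, ⟨hHw, hKw⟩, fun v hv _ _ => hv⟩
      · exact step K hKw fun v _ h => h
    · exact step H hHw fun v h _ => h

/-- The least upper bound of two closure operators on a finite poset fixes every element
fixed by both. -/
theorem isLUB_apply_eq_self [Finite P] {H K J : ClosureOperator P} (hJ : IsLUB {H, K} J)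
    {x : P} (hHx : H x = x) (hKx : K x = x) : J x = x := by
  choose f hle hclosed hmin using exists_least_common_closed H K
  let U : ClosureOperator P := ofPred f (fun u => H u = u ∧ K u = u) hle hclosed
    fun w v hwv hv => hmin w v hwv hv.1 hv.2
  have hJU : J ≤ U := by
    refine hJ.2 ?_
    rintro F (rfl | rfl) w
    · exact (F.monotone (hle w)).trans_eq (hclosed w).1
    · exact (F.monotone (hle w)).trans_eq (hclosed w).2
  exact le_antisymm ((hJU x).trans (hmin x x le_rfl hHx hKx)) (J.le_closure x)

/-- The pointwise minimum of two closure operators whose values are everywhere comparable. -/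
noncomputable def pointwiseMin (H K : ClosureOperator P) (h : ∀ w, H w ≤ K w ∨ K w ≤ H w) :
    ClosureOperator P := by
  classical
  have hl (w : P) : (if H w ≤ K w then H w else K w) ≤ H w := by
    split_ifs with hw
    exacts [le_rfl, (h w).resolve_left hw]
  have hr (w : P) : (if H w ≤ K w then H w else K w) ≤ K w := by
    split_ifs with hw
    exacts [hw, le_rfl]
  exact mk' (fun w => if H w ≤ K w then H w else K w)
    (fun v w hvw => by
      change _ ≤ (if H w ≤ K w then H w else K w)
      split_ifs with hw
      exacts [(hl v).trans (H.monotone hvw), (hr v).trans (K.monotone hvw)])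
    (fun w => by
      split_ifs
      exacts [H.le_closure w, K.le_closure w])
    (fun w => by
      by_cases hw : H w ≤ K w
      · simpa only [if_pos hw, H.idempotent w] using hl (H w)
      · simpa only [if_neg hw, K.idempotent w] using hr (K w))

theorem pointwiseMin_apply_eq_or (H K : ClosureOperator P)
    (h : ∀ w, H w ≤ K w ∨ K w ≤ H w) (w : P) :
    (pointwiseMin H K h w = H w ∧ H w ≤ K w) ∨ (pointwiseMin H K h w = K w ∧ K w ≤ H w) := by
  classical
  by_cases hw : H w ≤ K w
  · exact .inl ⟨if_pos hw, hw⟩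
  · exact .inr ⟨if_neg hw, (h w).resolve_left hw⟩

end ClosureOperator

/-- Under the cover property, `H x` is comparable to every element above `x`. -/
theorem CoverProperty.comparable {P : Type*} [PartialOrder P] [Finite P]
    {H : ClosureOperator P} (hH : CoverProperty H) (x z : P) (hxz : x ≤ z) :
    H x ≤ z ∨ z ≤ H x := by
  induction x using (wellFounded_gt (α := P)).induction with
  | _ x ih =>
    by_cases hx : H x = x
    · exact .inl (hx.trans_le hxz)
    · obtain rfl | hlt := hxz.eq_or_lt
      · exact .inr (H.le_closure x)
      · obtain ⟨y, hxy, hyz⟩ := exists_covBy_le_of_lt hlt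
        simpa only [hH x y hxy hx] using ih y hxy.lt hyz

/-- For a finite poset `P`, any closure relation `H` with the cover property is
a modular element of the lattice of closure relations: for all `K ≤ K'`, if `H ⊔ K = H ⊔ K'`
and `H ⊓ K = H ⊓ K'` then `K = K'` (joins and meets expressed via `IsLUB`/`IsGLB`). -/
theorem coverProperty_modular {P : Type*} [PartialOrder P] [Finite P]
    (H : ClosureOperator P) (hH : CoverProperty H) :
    ∀ K K' J M : ClosureOperator P, K ≤ K' →
      IsLUB {H, K} J → IsLUB {H, K'} J →
      IsGLB {H, K} M → IsGLB {H, K'} M → K = K' := by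
  intro K K' J M hKK' hJ hJ' hM hM'
  have fixed {x : P} (hx : K x = x) : K' x = x := by
    by_cases hHx : H x = x
    · have hJx := ClosureOperator.isLUB_apply_eq_self hJ hHx hx
      have hK'J : K' ≤ J := hJ'.1 (by simp)
      exact le_antisymm ((hK'J x).trans_eq hJx) (K'.le_closure x)
    · let L := ClosureOperator.pointwiseMin H K'
        fun w => hH.comparable w (K' w) (K'.le_closure w)
      have hL (w : P) : (L w = H w ∧ H w ≤ K' w) ∨ (L w = K' w ∧ K' w ≤ H w) :=
        ClosureOperator.pointwiseMin_apply_eq_or H K' _ w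
      have hLM : L ≤ M := by
        refine hM'.2 ?_
        rintro F (rfl | rfl) w
        · rcases hL w with h | h
          exacts [h.1.le, h.1.trans_le h.2]
        · rcases hL w with h | h
          exacts [h.1.trans_le h.2, h.1.le]
      have hMK : M ≤ K := hM.1 (by simp)
      have hLx : L x ≤ x := ((hLM x).trans (hMK x)).trans_eq hx
      rcases hL x with h | h
      · exact absurd (le_antisymm (h.1.symm.trans_le hLx) (H.le_closure x)) hHx
      · exact le_antisymm (h.1.symm.trans_le hLx) (K'.le_closure x)
  refine le_antisymm hKK' fun x => ?_
  exact (K'.monotone (K.le_closure x)).trans_eq (fixed (K.idempotent x))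
end

section
/- Let P be a finite partial order with a greatest element. A closure relation H on P is a modular element of the lattice of closure relations on P if and only if H satisfies the cover property: for all x, y ∈ P, if y covers x and H(x) ≠ x, then H(y) = H(x). -/
namespace ClosureOperator

section Preliminaries

variable {P : Type*} [PartialOrder P]

theorem apply_apply_of_le {A B : ClosureOperator P} (h : A ≤ B) (x : P) : A (B x) = B x :=
  le_antisymm ((h (B x)).trans (B.idempotent x).le) (A.le_closure _)

theorem exists_least_common_fixed [Finite P] (S : Set (ClosureOperator P)) (x : P) :
    ∃ m, x ≤ m ∧ (∀ A ∈ S, A m = m) ∧ ∀ c, x ≤ c → (∀ A ∈ S, A c = c) → m ≤ c := by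
  obtain ⟨m, hm⟩ := (Set.toFinite
    {z | x ≤ z ∧ ∀ c, x ≤ c → (∀ A ∈ S, A c = c) → z ≤ c}).exists_maximal
    ⟨x, le_rfl, fun c hc _ => hc⟩
  refine ⟨m, hm.prop.1, fun A hA => ?_, hm.prop.2⟩
  refine le_antisymm (hm.le_of_ge ⟨hm.prop.1.trans (A.le_closure m), fun c hc hS => ?_⟩
    (A.le_closure m)) (A.le_closure m)
  exact (A.monotone (hm.prop.2 c hc hS)).trans (hS A hA).le

theorem exists_isLUB_and_apply_eq [Finite P] (S : Set (ClosureOperator P)) :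
    ∃ J, IsLUB S J ∧ ∀ x, (∀ A ∈ S, A x = x) → J x = x := by
  choose f hle hfix hmin using exists_least_common_fixed S
  refine ⟨ClosureOperator.mk₂ f hle fun x y hxy => hmin x _ hxy (hfix y), ⟨?_, ?_⟩, ?_⟩
  · intro A hA x
    exact (A.monotone (hle x)).trans (hfix x A hA).le
  · intro B hB x
    exact hmin x _ (B.le_closure x) fun A hA => apply_apply_of_le (hB hA) x
  · intro x hx
    exact le_antisymm (hmin x x le_rfl hx) (hle x)

theorem exists_isLUB [Finite P] (S : Set (ClosureOperator P)) : ∃ J, IsLUB S J :=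
  (exists_isLUB_and_apply_eq S).imp fun _ => And.left

theorem apply_eq_of_isLUB [Finite P] {S : Set (ClosureOperator P)} {J : ClosureOperator P}
    (hJ : IsLUB S J) {x : P} (hx : ∀ A ∈ S, A x = x) : J x = x := by
  obtain ⟨J', hJ', h⟩ := exists_isLUB_and_apply_eq S
  rw [hJ.unique hJ']
  exact h x hx

theorem exists_isGLB [Finite P] (S : Set (ClosureOperator P)) : ∃ M, IsGLB S M :=
  (exists_isLUB (lowerBounds S)).imp fun _ => isLUB_lowerBounds.1

/-- If the values of two closure operators are comparable at every point, their pointwise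
minimum is a closure operator. -/
theorem exists_pointwise_min (A B : ClosureOperator P) (h : ∀ x, A x ≤ B x ∨ B x ≤ A x) :
    ∃ C : ClosureOperator P, C ≤ A ∧ C ≤ B ∧ ∀ x, C x = A x ∨ C x = B x := by
  have hmin : ∀ x, ∃ m, m ≤ A x ∧ m ≤ B x ∧ (m = A x ∨ m = B x) := fun x =>
    (h x).elim (fun h => ⟨A x, le_rfl, h, .inl rfl⟩) fun h => ⟨B x, h, le_rfl, .inr rfl⟩
  choose f hA hB hf using hmin
  have hle : ∀ {x m}, m ≤ A x → m ≤ B x → m ≤ f x := by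
    intro x m h₁ h₂
    rcases hf x with h | h <;> rw [h] <;> assumption
  refine ⟨ClosureOperator.mk' f
    (fun x y hxy => hle ((hA x).trans (A.monotone hxy)) ((hB x).trans (B.monotone hxy)))
    (fun x => hle (A.le_closure x) (B.le_closure x)) (fun x => ?_), hA, hB, hf⟩
  rcases hf x with h | h
  · exact (hA _).trans (by rw [h, A.idempotent])
  · exact (hB _).trans (by rw [h, B.idempotent])

/-- Under the cover property, every element above a non-closed `x` is comparable to `H x`. -/
theorem le_or_ge_of_coverProperty [Finite P] {H : ClosureOperator P}
    (hH : ∀ x y : P, x ⋖ y → H x ≠ x → H y = H x) {x y : P} (hxy : x ≤ y) :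
    H x ≤ y ∨ y ≤ H x := by
  induction x using (wellFounded_gt (α := P)).induction with
  | _ x ih =>
    rcases hxy.eq_or_lt with rfl | hlt
    · exact .inr (H.le_closure x)
    by_cases hx : H x = x
    · exact .inl (hx.le.trans hxy)
    have : Fintype P := Fintype.ofFinite P
    obtain ⟨z, hxz, hzy⟩ := exists_covBy_le_of_lt hlt
    rw [← hH x z hxz hx]
    exact ih z hxz.lt hzy

end Preliminaries

section Chains

variable {P : Type*} [PartialOrder P] [OrderTop P]

open Classical in
/-- The closure operator whose closed elements are `y` and `⊤`. -/
noncomputable def ofPoint (y : P) : ClosureOperator P :=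
  ClosureOperator.mk₂ (fun z => if z ≤ y then y else ⊤)
    (fun z => by split_ifs <;> simp_all)
    (fun z w h => by
      by_cases hw : w ≤ y
      · simp_all
      · simp [hw])

open Classical in
/-- The closure operator whose closed elements are `x`, `y` and `⊤`, for `x ≤ y`. -/
noncomputable def ofPair (x y : P) (hxy : x ≤ y) : ClosureOperator P :=
  ClosureOperator.mk₂ (fun z => if z ≤ x then x else if z ≤ y then y else ⊤)
    (fun z => by split_ifs <;> simp_all)
    (fun z w h => by
      by_cases hx : w ≤ x
      · simp_all
      by_cases hy : w ≤ y
      · simp only [hx, hy, if_true, if_false] at h ⊢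
        split_ifs <;> simp_all
      · simp [hx, hy])

open Classical in
theorem ofPoint_apply (y z : P) : ofPoint y z = if z ≤ y then y else ⊤ := rfl

open Classical in
theorem ofPair_apply (x y : P) (hxy : x ≤ y) (z : P) :
    ofPair x y hxy z = if z ≤ x then x else if z ≤ y then y else ⊤ := rfl

theorem ofPair_le_ofPoint {x y : P} (hxy : x ≤ y) : ofPair x y hxy ≤ ofPoint y := by
  intro z
  change ofPair x y hxy z ≤ ofPoint y z
  rw [ofPair_apply, ofPoint_apply]
  by_cases hx : z ≤ x
  · simp [hx, hx.trans hxy, hxy]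
  · simp [hx]

theorem ofPoint_le_of_ofPair_le {x y : P} (hxy : x ≤ y) {U : ClosureOperator P}
    (hU : ofPair x y hxy ≤ U) (hx : U x ≠ x) : ofPoint y ≤ U := by
  intro z
  change ofPoint y z ≤ U z
  have hz : ofPair x y hxy z ≤ U z := hU z
  have hfix := apply_apply_of_le hU z
  rw [ofPair_apply] at hz hfix
  rw [ofPoint_apply]
  by_cases hzx : z ≤ x
  · rw [if_pos (hzx.trans hxy)]
    split_ifs at hfix with h₁ h₂
    · exact absurd (by rw [hfix, U.idempotent]) hx
    · exact hfix.le
    · exact le_top.trans hfix.le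
  · rwa [if_neg hzx] at hz

theorem le_ofPair_of_le_ofPoint {x y : P} (hxy : x ≤ y) {N : ClosureOperator P}
    (hN : N ≤ ofPoint y) (hx : N x = x) : N ≤ ofPair x y hxy := by
  intro z
  change N z ≤ ofPair x y hxy z
  rw [ofPair_apply]
  split_ifs with h₁ h₂
  · exact (N.monotone h₁).trans hx.le
  · exact (hN z).trans (by change ofPoint y z ≤ y; simp [ofPoint_apply, h₂])
  · exact le_top

end Chains

end ClosureOperator

open ClosureOperator in
theorem eq_of_isLUB_of_isGLB_of_coverProperty {P : Type*} [PartialOrder P] [Finite P]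
    {H K K' J M : ClosureOperator P}
    (hH : ∀ x y : P, x ⋖ y → H x ≠ x → H y = H x) (hKK' : K ≤ K')
    (hJ : IsLUB {H, K} J) (hJ' : IsLUB {H, K'} J)
    (hM : IsGLB {H, K} M) (hM' : IsGLB {H, K'} M) : K = K' := by
  obtain ⟨C, hCH, hCK, hC⟩ := exists_pointwise_min H K' fun x => by
    rcases le_or_ge_of_coverProperty hH (K'.le_closure x) with h | h
    exacts [.inl h, .inr h]
  have hCM : C ≤ M := hM'.2 (by rintro _ (rfl | rfl) <;> assumption)
  have hMK : M ≤ K := hM.1 (by simp)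
  refine le_antisymm hKK' fun z => ?_
  change K' z ≤ K z
  suffices h : K' (K z) = K z from (K'.monotone (K.le_closure z)).trans h.le
  have hKz : K (K z) = K z := K.idempotent z
  generalize K z = x at hKz
  have hCx : C x = x := le_antisymm (((hCM.trans hMK) x).trans hKz.le) (C.le_closure x)
  rcases hC x with h | h
  · have hHx : H x = x := h.symm.trans hCx
    have hJx : J x = x := apply_eq_of_isLUB hJ (by rintro _ (rfl | rfl) <;> assumption)
    have hK'J : K' ≤ J := hJ'.1 (by simp)
    exact le_antisymm ((hK'J x).trans hJx.le) (K'.le_closure x)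
  · exact h.symm.trans hCx

open ClosureOperator in
theorem coverProperty_of_modular {P : Type*} [PartialOrder P] [OrderTop P] [Finite P]
    {H : ClosureOperator P}
    (hmod : ∀ K K' J M : ClosureOperator P, K ≤ K' →
      IsLUB {H, K} J → IsLUB {H, K'} J → IsGLB {H, K} M → IsGLB {H, K'} M → K = K')
    {x y : P} (hxy : x ⋖ y) (hx : H x ≠ x) : H y = H x := by
  by_contra hy
  have hyx : ¬ y ≤ H x := fun h =>
    hy (le_antisymm ((H.le_closure_iff).1 h) (H.monotone hxy.le))
  have hle := ofPair_le_ofPoint hxy.le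
  have hub : upperBounds {H, ofPair x y hxy.le} = upperBounds {H, ofPoint y} := by
    ext U
    simp only [upperBounds_insert, upperBounds_singleton, Set.mem_inter_iff, Set.mem_Ici]
    refine and_congr_right fun hU => ⟨fun h => ofPoint_le_of_ofPair_le hxy.le h fun hUx => ?_,
      hle.trans⟩
    exact hx (le_antisymm ((hU x).trans hUx.le) (H.le_closure x))
  have hlb : lowerBounds {H, ofPair x y hxy.le} = lowerBounds {H, ofPoint y} := by
    ext N
    simp only [lowerBounds_insert, lowerBounds_singleton, Set.mem_inter_iff, Set.mem_Iic]
    refine and_congr_right fun hN => ⟨fun h => h.trans hle,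
      fun h => le_ofPair_of_le_ofPoint hxy.le h ?_⟩
    have hNy : N x ≤ y := (h x).trans (by change ofPoint y x ≤ y; simp [ofPoint_apply, hxy.le])
    refine (hxy.eq_or_eq (N.le_closure x) hNy).resolve_right fun hNx => hyx ?_
    exact hNx.ge.trans (hN x)
  obtain ⟨J, hJ⟩ := exists_isLUB {H, ofPair x y hxy.le}
  obtain ⟨M, hM⟩ := exists_isGLB {H, ofPair x y hxy.le}
  have heq := hmod (ofPair x y hxy.le) (ofPoint y) J M hle hJ (by rwa [IsLUB, ← hub]) hM
    (by rwa [IsGLB, ← hlb])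
  have hxx := DFunLike.congr_fun heq x
  rw [ofPair_apply, ofPoint_apply, if_pos le_rfl, if_pos hxy.le] at hxx
  exact hxy.ne hxx

/-- Let `P` be a finite poset with a greatest element.  A closure relation `H`
on `P` is a modular element of the lattice of closure relations (for all `K ≤ K'`, if
`H ⊔ K = H ⊔ K'` and `H ⊓ K = H ⊓ K'` then `K = K'`, joins/meets expressed via
`IsLUB`/`IsGLB`) if and only if `H` has the cover property: whenever `y` covers `x` in `P` and
`H x ≠ x`, then `H y = H x`. -/
theorem modular_iff_coverProperty {P : Type*} [PartialOrder P] [OrderTop P] [Finite P]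
    (H : ClosureOperator P) :
    (∀ K K' J M : ClosureOperator P, K ≤ K' →
      IsLUB {H, K} J → IsLUB {H, K'} J →
      IsGLB {H, K} M → IsGLB {H, K'} M → K = K') ↔
    (∀ x y : P, x ⋖ y → H x ≠ x → H y = H x) := by
  exact ⟨fun hmod _ _ => coverProperty_of_modular hmod, fun hH _ _ _ _ =>
    eq_of_isLUB_of_isGLB_of_coverProperty hH⟩
end

section
/- Let P be a finite partial order and let H be a closure relation on P satisfying the cover property. If x ∈ P satisfies H(x) ≠ x, then every y ≥ x in P is comparable to H(x); moreover, if in addition y is not ≥ H(x), then y < H(x) and H(y) = H(x). -/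
/-- The closure is constant on the elements above `x` but not above `H x`. -/
theorem CoverProperty.apply_eq_of_not_le {P : Type*} [PartialOrder P] [Finite P]
    {H : ClosureOperator P} (hH : CoverProperty H) {x y : P} (hxy : x ≤ y)
    (hy : ¬ H x ≤ y) : H y = H x := by
  classical
  have := Fintype.ofFinite P
  let _ : LocallyFiniteOrder P := Fintype.toLocallyFiniteOrder
  have chain := le_iff_reflTransGen_covBy.1 hxy
  clear hxy
  induction chain with
  | refl => rfl
  | @tail z y _ hzy ih =>
    have hz : ¬ H x ≤ z := fun h ↦ hy (h.trans hzy.le)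
    have hzx := ih hz
    rw [hH z y hzy fun h ↦ hz (hzx.symm.trans h).le, hzx]

/-- Let `H` be a closure relation with the cover property on a finite poset `P`.
If `H x ≠ x`, then every `y ≥ x` is comparable to `H x`; moreover if in addition `¬(H x ≤ y)`
then `y < H x` and `H y = H x`. -/
theorem coverProperty_comparable {P : Type*} [PartialOrder P] [Finite P]
    (H : ClosureOperator P) (hH : CoverProperty H)
    {x : P} (hx : H x ≠ x) {y : P} (hxy : x ≤ y) :
    (y ≤ H x ∨ H x ≤ y) ∧ (¬ H x ≤ y → y < H x ∧ H y = H x) := by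
  have key (h : ¬ H x ≤ y) : y < H x ∧ H y = H x := by
    have e := hH.apply_eq_of_not_le hxy h
    exact ⟨lt_of_le_not_ge (e ▸ H.le_closure y) h, e⟩
  exact ⟨(em (H x ≤ y)).elim Or.inr fun h ↦ Or.inl (key h).1.le, key⟩
end

section
/- Let P be a finite partial order with greatest element ⊤, and let p_1, p_2, …, p_n be a linear extension of P (an enumeration of all elements of P such that p_i ≤ p_j in P implies i ≤ j). Then for each i = 0, 1, …, n the set A_i = {⊤} ∪ {p_1, …, p_i} is mlb-closed, and the closure relation H_i with closed set A_i satisfies the cover property: whenever y covers x in P and H_i(x) ≠ x, then H_i(y) = H_i(x). -/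
theorem IsLowerSet.mlbClosed_singleton_top_union {P : Type*} [PartialOrder P] [OrderTop P]
    {L : Set P} (hL : IsLowerSet L) : MlbClosed ({⊤} ∪ L) := by
  rintro B hB x ⟨hx, hmax⟩
  by_cases hBL : ∃ b ∈ B, b ∈ L
  · obtain ⟨b, hb, hbL⟩ := hBL
    exact Or.inr (hL (hx hb) hbL)
  · have htop : ⊤ ∈ lowerBounds B := fun b hb =>
      ((hB hb).resolve_right fun hbL => hBL ⟨b, hb, hbL⟩).ge
    exact Or.inl (hmax ⊤ htop le_top)

theorem ClosureOperator.eq_top_of_setOf_eq_singleton_top_union {P : Type*} [PartialOrder P]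
    [OrderTop P] {L : Set P} (hL : IsLowerSet L) (H : ClosureOperator P)
    (hH : {x : P | H x = x} = {⊤} ∪ L) {x : P} (hx : H x ≠ x) : H x = ⊤ := by
  have hHx : H x ∈ {⊤} ∪ L := hH ▸ H.idempotent x
  refine hHx.resolve_right fun h => hx ?_
  have hxA : x ∈ {x : P | H x = x} := hH ▸ Or.inr (hL (H.le_closure x) h)
  exact hxA

theorem isLowerSet_image_initial_of_linearExtension {P : Type*} [PartialOrder P] {n : ℕ}
    {p : Fin n → P} (hsurj : Function.Surjective p) (hext : ∀ i j : Fin n, p i ≤ p j → i ≤ j)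
    (i : ℕ) : IsLowerSet (p '' {j : Fin n | (j : ℕ) < i}) := by
  rintro _ b hb ⟨j, hj, rfl⟩
  obtain ⟨k, rfl⟩ := hsurj b
  exact ⟨k, (Fin.le_def.mp (hext k j hb)).trans_lt hj, rfl⟩

/-- Let `P` be a finite poset with greatest element `⊤`, and let
`p 0, p 1, …, p (n-1)` be a linear extension of `P` (a bijective enumeration of the elements
of `P` such that `p i ≤ p j` in `P` implies `i ≤ j`).  Then for each `i ≤ n`, the set
`A i = {⊤} ∪ {p j : j < i}` is mlb-closed, and the closure relation with closed set `A i`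
satisfies the cover property: whenever `y` covers `x` in `P` and `H x ≠ x`, then `H y = H x`. -/
theorem linearExtension_modular_chain {P : Type*} [PartialOrder P] [OrderTop P] [Finite P]
    {n : ℕ} (p : Fin n → P) (hbij : Function.Bijective p)
    (hext : ∀ i j : Fin n, p i ≤ p j → i ≤ j) :
    ∀ i : ℕ, i ≤ n →
      MlbClosed (({⊤} : Set P) ∪ p '' {j : Fin n | (j : ℕ) < i}) ∧
      ∀ H : ClosureOperator P,
        {x : P | H x = x} = ({⊤} : Set P) ∪ p '' {j : Fin n | (j : ℕ) < i} →
        ∀ x y : P, x ⋖ y → H x ≠ x → H y = H x := by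
  intro i _
  have hL := isLowerSet_image_initial_of_linearExtension hbij.surjective hext i
  refine ⟨hL.mlbClosed_singleton_top_union, fun H hH x y hxy hx => ?_⟩
  have htop := H.eq_top_of_setOf_eq_singleton_top_union hL hH hx
  rw [htop, eq_top_iff, ← htop]
  exact H.monotone hxy.le
end

section
/- Let P be a finite partial order. Then the lattice of closure relations on P (ordered pointwise) is supersolvable: it contains a maximal chain all of whose elements are modular elements, where h is a modular element if for all closure relations k ≤ k', h ⊔ k = h ⊔ k' and h ⊓ k = h ⊓ k' imply k = k'. -/
namespace ClosureOperator

variable {P : Type*} [PartialOrder P]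

/-- The closure relation that fixes the elements of the lower set `D` and agrees with `K` off `D`. -/
noncomputable def fixOn (D : Set P) (hD : IsLowerSet D) (K : ClosureOperator P) :
    ClosureOperator P := by
  classical
  exact mk' (fun x => if x ∈ D then x else K x)
    (by
      intro x y hxy
      dsimp only
      by_cases hy : y ∈ D
      · rw [if_pos hy, if_pos (hD hxy hy)]
        exact hxy
      · rw [if_neg hy]
        split_ifs
        · exact hxy.trans (K.le_closure y)
        · exact K.monotone hxy)
    (by
      intro x
      split_ifs
      · exact le_rfl
      · exact K.le_closure x)
    (by
      intro x
      by_cases hx : x ∈ D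
      · rw [if_pos hx, if_pos hx]
      · have hKx : K x ∉ D := fun h => hx (hD (K.le_closure x) h)
        rw [if_neg hx, if_neg hKx, K.idempotent])

theorem fixOn_of_mem {D : Set P} (hD : IsLowerSet D) (K : ClosureOperator P) {x : P}
    (hx : x ∈ D) : fixOn D hD K x = x :=
  if_pos hx

theorem fixOn_of_notMem {D : Set P} (hD : IsLowerSet D) (K : ClosureOperator P) {x : P}
    (hx : x ∉ D) : fixOn D hD K x = K x :=
  if_neg hx

theorem fixOn_le (D : Set P) (hD : IsLowerSet D) (K : ClosureOperator P) : fixOn D hD K ≤ K := by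
  intro x
  by_cases hx : x ∈ D
  · exact (fixOn_of_mem hD K hx).trans_le (K.le_closure x)
  · exact (fixOn_of_notMem hD K hx).le

theorem fixOn_mono {D : Set P} (hD : IsLowerSet D) {H K : ClosureOperator P} (hHK : H ≤ K) :
    fixOn D hD H ≤ fixOn D hD K := by
  intro x
  by_cases hx : x ∈ D
  · exact ((fixOn_of_mem hD H hx).trans (fixOn_of_mem hD K hx).symm).le
  · exact (fixOn_of_notMem hD H hx).trans_le
      ((hHK x).trans (fixOn_of_notMem hD K hx).ge)

theorem fixOn_anti {D E : Set P} (hD : IsLowerSet D) (hE : IsLowerSet E) (hDE : D ⊆ E)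
    (K : ClosureOperator P) : fixOn E hE K ≤ fixOn D hD K := by
  intro x
  by_cases hx : x ∈ E
  · exact (fixOn_of_mem hE K hx).trans_le ((fixOn D hD K).le_closure x)
  · exact ((fixOn_of_notMem hE K hx).trans
      (fixOn_of_notMem hD K fun h => hx (hDE h)).symm).le

/-- Every family of closure relations on a finite poset has an upper bound whose fixed points
are exactly the common fixed points of the family. -/
theorem exists_mem_upperBounds_fixing [Finite P] (S : Set (ClosureOperator P)) :
    ∃ J ∈ upperBounds S, ∀ z, (∀ f ∈ S, f z = z) → J z = z := by
  have least : ∀ x : P, ∃ y, IsLeast {z | x ≤ z ∧ ∀ f ∈ S, f z = z} y := by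
    intro x
    induction x using WellFoundedGT.induction with
    | ind x ih =>
      by_cases hx : ∀ f ∈ S, f x = x
      · exact ⟨x, ⟨le_rfl, hx⟩, fun z hz => hz.1⟩
      · push Not at hx
        obtain ⟨f, hf, hfx⟩ := hx
        obtain ⟨y, hy, hmin⟩ := ih (f x) (lt_of_le_of_ne (f.le_closure x) (Ne.symm hfx))
        refine ⟨y, ⟨(f.le_closure x).trans hy.1, hy.2⟩, fun z hz => hmin ⟨?_, hz.2⟩⟩
        exact (f.monotone hz.1).trans_eq (hz.2 f hf)
  choose c hc hmin using least
  refine ⟨mk' c (fun x y hxy => hmin x ⟨hxy.trans (hc y).1, (hc y).2⟩) (fun x => (hc x).1)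
    (fun x => hmin (c x) ⟨le_rfl, (hc x).2⟩), ?_, ?_⟩
  · intro f hf x
    exact (f.monotone (hc x).1).trans_eq ((hc x).2 f hf)
  · intro z hz
    exact le_antisymm (hmin z ⟨le_rfl, hz⟩) (hc z).1

/-- If `K` is the greatest closure relation, each `fixOn D hD K` is a modular element. -/
theorem fixOn_modular [Finite P] {D : Set P} (hD : IsLowerSet D) {K : ClosureOperator P}
    (hK : ∀ f, f ≤ K) {k k' j m : ClosureOperator P} (hkk' : k ≤ k')
    (hj : IsLUB {fixOn D hD K, k} j) (hj' : IsLUB {fixOn D hD K, k'} j)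
    (hm : IsGLB {fixOn D hD K, k} m) (hm' : IsGLB {fixOn D hD K, k'} m) : k = k' := by
  suffices key : ∀ z, k z = z → k' z ≤ z from le_antisymm hkk' fun x =>
    (k'.monotone (k.le_closure x)).trans (key (k x) (k.idempotent x))
  intro z hz
  by_cases hzD : z ∈ D
  · obtain ⟨J, hJ, hJfix⟩ := exists_mem_upperBounds_fixing {fixOn D hD K, k}
    have hJz : J z = z := hJfix z (by
      rintro f (rfl | rfl)
      · exact fixOn_of_mem hD K hzD
      · exact hz)
    have hk'J : k' ≤ J := (hj'.1 (by simp)).trans (hj.2 hJ)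
    exact (hk'J z).trans_eq hJz
  · have hle : fixOn D hD k' ≤ m := hm'.2 (by
      rintro f (rfl | rfl)
      · exact fixOn_mono hD (hK k')
      · exact fixOn_le D hD _)
    have hmk : m ≤ k := hm.1 (by simp)
    exact (fixOn_of_notMem hD k' hzD).ge.trans (((hle.trans hmk) z).trans_eq hz)

/-- The maximal chain attached to a linear extension `s` of the order: its members fix an initial
segment of `s` and agree with the greatest closure relation elsewhere. -/
theorem isMaxChain_fixOn (s : P → P → Prop) [IsLinearOrder P s] (hs : ∀ x y : P, x ≤ y → s x y)
    {K : ClosureOperator P} (hK : ∀ f, f ≤ K) :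
    IsMaxChain (· ≤ ·) {h : ClosureOperator P | ∃ (D : Set P) (hD : IsLowerSet D),
      (∀ x y, s x y → y ∈ D → x ∈ D) ∧ h = fixOn D hD K} := by
  refine ⟨?_, fun C hC hsub => hsub.antisymm fun g hg => ?_⟩
  · rintro _ ⟨D, hD, hDs, rfl⟩ _ ⟨E, hE, hEs, rfl⟩ -
    have htot : D ⊆ E ∨ E ⊆ D := by
      by_contra! hcon
      obtain ⟨⟨x, hxD, hxE⟩, ⟨y, hyE, hyD⟩⟩ := hcon.imp Set.not_subset.1 Set.not_subset.1
      rcases total_of s x y with hxy | hyx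
      · exact hxE (hEs x y hxy hyE)
      · exact hyD (hDs y x hyx hxD)
    rcases htot with h | h
    · exact Or.inr (fixOn_anti hD hE h K)
    · exact Or.inl (fixOn_anti hE hD h K)
  · have lower {D : Set P} (hDs : ∀ x y, s x y → y ∈ D → x ∈ D) : IsLowerSet D :=
      fun y x hxy hy => hDs x y (hs x y hxy) hy
    let D : Set P := {x | ∀ z, s z x → g z = z}
    have hDs : ∀ x y, s x y → y ∈ D → x ∈ D := fun x y hxy hy z hzx =>
      hy z (trans_of s hzx hxy)
    refine ⟨D, lower hDs, hDs, ClosureOperator.ext _ _ fun y => ?_⟩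
    by_cases hy : y ∈ D
    · exact (hy y (refl_of s y)).trans (fixOn_of_mem _ K hy).symm
    · rw [fixOn_of_notMem _ K hy]
      refine le_antisymm (hK g y) ?_
      simp only [D, Set.mem_ofPred_eq] at hy
      push Not at hy
      obtain ⟨z, hzy, hgz⟩ := hy
      let E : Set P := {w | s w z}
      have hEs : ∀ x y, s x y → y ∈ E → x ∈ E := fun x y hxy hy => trans_of s hxy hy
      have hEg : fixOn E (lower hEs) K ≤ g := by
        refine (hC.total hg (hsub ⟨E, lower hEs, hEs, rfl⟩)).resolve_left fun hle => hgz ?_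
        exact le_antisymm ((hle z).trans_eq (fixOn_of_mem _ K (refl_of s z))) (g.le_closure z)
      have hgy : g y ∉ E := by
        intro hmem
        have heq : g y = z := antisymm_of s hmem (trans_of s hzy (hs _ _ (g.le_closure y)))
        exact hgz (heq ▸ g.idempotent y)
      calc K y ≤ K (g y) := K.monotone (g.le_closure y)
        _ = fixOn E (lower hEs) K (g y) := (fixOn_of_notMem _ K hgy).symm
        _ ≤ g (g y) := hEg (g y)
        _ = g y := g.idempotent y

end ClosureOperator

/-- For a finite poset `P`, the lattice of closure relations on `P` (ordered
pointwise) is supersolvable: it contains a maximal chain all of whose members are modular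
elements, where `h` is modular if for all `k ≤ k'`, `h ⊔ k = h ⊔ k'` and `h ⊓ k = h ⊓ k'`
imply `k = k'` (joins/meets expressed via `IsLUB`/`IsGLB`). -/
theorem closureLattice_supersolvable {P : Type*} [PartialOrder P] [Finite P] :
    ∃ C : Set (ClosureOperator P), IsMaxChain (· ≤ ·) C ∧
      ∀ h ∈ C, ∀ k k' j m : ClosureOperator P, k ≤ k' →
        IsLUB {h, k} j → IsLUB {h, k'} j →
        IsGLB {h, k} m → IsGLB {h, k'} m → k = k' := by
  obtain ⟨s, hs, hle⟩ := extend_partialOrder (α := P) (· ≤ ·)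
  obtain ⟨K, hK, -⟩ := ClosureOperator.exists_mem_upperBounds_fixing (P := P) Set.univ
  have hK' : ∀ f, f ≤ K := fun f => hK (Set.mem_univ f)
  refine ⟨_, ClosureOperator.isMaxChain_fixOn s (fun x y => hle x y) hK', ?_⟩
  rintro _ ⟨D, hD, -, rfl⟩ k k' j m hkk' hj hj' hm hm'
  exact ClosureOperator.fixOn_modular hD hK' hkk' hj hj' hm hm'
end
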